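/- Let β ∈ (0,1/4] and let H : [0,1] → [H̲,H̄] with 1/α < H̲ ≤ H̄ < 1 satisfy |H(t₁) − H(t₂)| ≤ c_H |t₁ − t₂|^{ρ_H} for all t₁,t₂ ∈ [0,1], where c_H > 0 and H̄ < ρ_H ≤ 1. For a compact interval I ⊆ [0,1] and integer N set S_N(I) = Σ_{k ∈ ν_N(I)} ‖Φ_α(·, H(k/N))‖_{L^α(ℝ)}^β N^{−β H(k/N)}, W_N(I) = Σ_{k ∈ ν_N(I)} ‖Φ_α(·, H(k/N))‖_{L^α(ℝ)}^β (2N)^{−β H(k/N)}, and T_{2N}(I) = Σ_{m ∈ ν_{2N}(I)} ‖Φ_α(·, H(m/(2N)))‖_{L^α(ℝ)}^β (2N)^{−β H(m/(2N))}. Then there exists a constant c > 0 (not depending on I and N) such that for every compact interval I ⊆ [0,1] and every integer N ≥ 4 with λ(I) ≥ 4(L+1) N^{−1} (log N)², one has | W_N(I)/S_N(I) − (|ν_N(I)| / |ν_{2N}(I)|) · (T_{2N}(I)/S_N(I)) | ≤ c · N^{−β ρ_H} (log N)³ + c · λ(I)^{−1} N^{−1} (log N)². -/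

import Mathlib

open MeasureTheory
open scoped Classical

/-- `(x)_+^κ = x^κ` if `x > 0`, and `0` otherwise. -/
noncomputable def posPow (x κ : ℝ) : ℝ := if 0 < x then x ^ κ else 0

/-- `Φ_α(u,v) = Σ_{l=0}^L a_l (l−u)_+^{v−1/α}` with `a_l = (−1)^{L−l}·(L choose l)`. -/
noncomputable def Phi (α : ℝ) (L : ℕ) (u v : ℝ) : ℝ :=
  ∑ l ∈ Finset.range (L + 1),
    ((-1 : ℝ) ^ (L - l) * (L.choose l : ℝ)) * posPow ((l : ℝ) - u) (v - 1 / α)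

/-- `‖Φ_α(·,v)‖_{L^α(ℝ)} = (∫_ℝ |Φ_α(u,v)|^α du)^{1/α}`. -/
noncomputable def PhiNorm (α : ℝ) (L : ℕ) (v : ℝ) : ℝ :=
  (∫ u : ℝ, |Phi α L u v| ^ α) ^ (1 / α)

/-- For `y ≥ 1`, the increment of `z ↦ z ^ κ * log z` over `[y, y + l]` is of order
`y ^ (κ + ε - 1)`. -/
lemma abs_rpow_mul_log_increment_le {K ε κ y l : ℝ} (hε : 0 < ε) (hK : K + ε < 1)
    (hκ : κ ∈ Set.Icc 0 K) (hy : 1 ≤ y) (hl : 0 ≤ l) :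
    |(y + l) ^ κ * Real.log (y + l) - y ^ κ * Real.log y| ≤
      (K / ε + 1) * l * y ^ (K + ε - 1) := by
  have hderiv : ∀ z ∈ Set.Icc y (y + l), HasDerivWithinAt (fun z : ℝ => z ^ κ * Real.log z)
      (κ * z ^ (κ - 1) * Real.log z + z ^ κ * z⁻¹) (Set.Icc y (y + l)) z := by
    intro z hz
    have hz0 : z ≠ 0 := by linarith [hz.1]
    exact ((Real.hasDerivAt_rpow_const (Or.inl hz0)).mul
      (Real.hasDerivAt_log hz0)).hasDerivWithinAt
  have hbound : ∀ z ∈ Set.Icc y (y + l),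
      ‖κ * z ^ (κ - 1) * Real.log z + z ^ κ * z⁻¹‖ ≤ (K / ε + 1) * y ^ (K + ε - 1) := by
    intro z hz
    have hz1 : 1 ≤ z := hy.trans hz.1
    have hz0 : 0 < z := by linarith
    have hlog : 0 ≤ Real.log z := Real.log_nonneg hz1
    have hlog' : Real.log z ≤ z ^ ε / ε := Real.log_le_rpow_div hz0.le hε
    have hpos : 0 ≤ κ * z ^ (κ - 1) * Real.log z + z ^ κ * z⁻¹ := by
      have := hκ.1
      positivity
    have hmul : z ^ κ * z⁻¹ = z ^ (κ - 1) := by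
      rw [Real.rpow_sub hz0, Real.rpow_one, div_eq_mul_inv]
    rw [Real.norm_of_nonneg hpos, hmul]
    have hle₁ : z ^ (κ - 1) ≤ z ^ (K + ε - 1) :=
      Real.rpow_le_rpow_of_exponent_le hz1 (by linarith [hκ.2])
    have hle₂ : z ^ (κ - 1) * z ^ ε ≤ z ^ (K + ε - 1) := by
      rw [← Real.rpow_add hz0]
      exact Real.rpow_le_rpow_of_exponent_le hz1 (by linarith [hκ.2])
    have hle₃ : z ^ (K + ε - 1) ≤ y ^ (K + ε - 1) :=
      Real.rpow_le_rpow_of_nonpos (by linarith) hz.1 (by linarith)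
    have hK0 : 0 ≤ K := hκ.1.trans hκ.2
    calc κ * z ^ (κ - 1) * Real.log z + z ^ (κ - 1)
        ≤ K * z ^ (κ - 1) * (z ^ ε / ε) + z ^ (κ - 1) := by
          gcongr
          exact hκ.2
      _ = K / ε * (z ^ (κ - 1) * z ^ ε) + z ^ (κ - 1) := by ring
      _ ≤ K / ε * y ^ (K + ε - 1) + y ^ (K + ε - 1) := by
          gcongr
          · exact hle₂.trans hle₃
          · exact hle₁.trans hle₃
      _ = _ := by ring
  have h := (convex_Icc y (y + l)).norm_image_sub_le_of_norm_hasDerivWithin_le hderiv hbound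
    (Set.left_mem_Icc.2 (by linarith)) (Set.right_mem_Icc.2 (by linarith))
  rw [Real.norm_eq_abs, add_sub_cancel_left, Real.norm_of_nonneg hl] at h
  calc _ ≤ _ := h
    _ = _ := by ring

lemma abs_rpow_increment_sub_le {K ε κ κ' y l : ℝ} (hε : 0 < ε) (hK : K + ε < 1)
    (hκ : κ ∈ Set.Icc 0 K) (hκ' : κ' ∈ Set.Icc 0 K) (hy : 1 ≤ y) (hl : 0 ≤ l) :
    |((y + l) ^ κ - y ^ κ) - ((y + l) ^ κ' - y ^ κ')| ≤
      (K / ε + 1) * l * y ^ (K + ε - 1) * |κ - κ'| := by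
  have hy0 : 0 < y := by linarith
  have hderiv : ∀ x ∈ Set.Icc 0 K, HasDerivWithinAt (fun x : ℝ => (y + l) ^ x - y ^ x)
      ((y + l) ^ x * Real.log (y + l) - y ^ x * Real.log y) (Set.Icc 0 K) x := fun x _ =>
    ((Real.hasStrictDerivAt_const_rpow (by linarith) x).hasDerivAt.sub
      (Real.hasStrictDerivAt_const_rpow hy0 x).hasDerivAt).hasDerivWithinAt
  exact (convex_Icc 0 K).norm_image_sub_le_of_norm_hasDerivWithin_le hderiv
    (fun x hx => abs_rpow_mul_log_increment_le hε hK hx hy hl) hκ' hκ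

lemma abs_posPow_le {B κ x : ℝ} (hB : 1 ≤ B) (hx : x ≤ B) (hκ : κ ∈ Set.Icc (0 : ℝ) 1) :
    |posPow x κ| ≤ B := by
  unfold posPow
  split_ifs with h
  · rw [abs_of_nonneg (by positivity)]
    calc x ^ κ ≤ B ^ κ := Real.rpow_le_rpow h.le hx hκ.1
      _ ≤ B ^ (1 : ℝ) := Real.rpow_le_rpow_of_exponent_le hB hκ.2
      _ = B := Real.rpow_one B
  · simp only [abs_zero]
    linarith

lemma abs_posPow_sub_le {k B κ κ' x : ℝ} (hk : 0 < k) (hB : 1 ≤ B) (hx : x ≤ B)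
    (hκ : κ ∈ Set.Icc k 1) (hκ' : κ' ∈ Set.Icc k 1) :
    |posPow x κ - posPow x κ'| ≤ (1 / k + B * B) * |κ - κ'| := by
  unfold posPow
  split_ifs with h
  · have hderiv : ∀ z ∈ Set.Icc k 1, HasDerivWithinAt (fun z : ℝ => x ^ z)
        (x ^ z * Real.log x) (Set.Icc k 1) z := fun z _ =>
      (Real.hasStrictDerivAt_const_rpow h z).hasDerivAt.hasDerivWithinAt
    refine (convex_Icc k 1).norm_image_sub_le_of_norm_hasDerivWithin_le hderiv
      (fun z hz => ?_) hκ' hκ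
    rw [Real.norm_eq_abs]
    have hz0 : 0 < z := hk.trans_le hz.1
    rcases le_total x 1 with hx1 | hx1
    · have h₁ := Real.abs_log_mul_self_rpow_lt x z h hx1 hz0
      rw [mul_comm]
      have h₂ : 1 / z ≤ 1 / k := one_div_le_one_div_of_le hk hz.1
      nlinarith
    · have h₁ := abs_posPow_le hB hx ⟨hz0.le, hz.2⟩
      rw [posPow, if_pos h] at h₁
      have h₂ : |Real.log x| ≤ B := by
        rw [abs_of_nonneg (Real.log_nonneg hx1)]
        linarith [Real.log_le_sub_one_of_pos h]
      rw [abs_mul]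
      have h₃ : 0 < 1 / k := by positivity
      have := mul_le_mul h₁ h₂ (abs_nonneg _) (by linarith)
      linarith
  · simp only [sub_self, abs_zero]
    positivity

lemma sum_alternating_choose_eq_zero {L : ℕ} (hL : 1 ≤ L) :
    ∑ l ∈ Finset.range (L + 1), ((-1 : ℝ) ^ (L - l) * (L.choose l : ℝ)) = 0 := by
  have h := add_pow (1 : ℝ) (-1) L
  simp only [one_pow, one_mul] at h
  rw [← h, add_neg_cancel, zero_pow (by lia)]

lemma sum_abs_alternating_choose (L : ℕ) :
    ∑ l ∈ Finset.range (L + 1), |(-1 : ℝ) ^ (L - l) * (L.choose l : ℝ)| = 2 ^ L := by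
  simp only [abs_mul, abs_pow, abs_neg, abs_one, one_pow, one_mul, Nat.abs_cast]
  exact_mod_cast Nat.sum_range_choose L

lemma abs_sum_mul_le {ι : Type*} {s : Finset ι} {a b : ι → ℝ} {M : ℝ}
    (h : ∀ i ∈ s, |b i| ≤ M) : |∑ i ∈ s, a i * b i| ≤ (∑ i ∈ s, |a i|) * M := by
  refine (Finset.abs_sum_le_sum_abs _ _).trans ?_
  rw [Finset.sum_mul]
  refine Finset.sum_le_sum fun i hi => ?_
  rw [abs_mul]
  gcongr
  exact h i hi

lemma Phi_eq_sum_increment {α u v : ℝ} {L : ℕ} (hL : 1 ≤ L) (hu : u < 0) :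
    Phi α L u v = ∑ l ∈ Finset.range (L + 1), ((-1 : ℝ) ^ (L - l) * (L.choose l : ℝ)) *
      ((-u + l) ^ (v - 1 / α) - (-u) ^ (v - 1 / α)) := by
  simp only [mul_sub, Finset.sum_sub_distrib]
  rw [← Finset.sum_mul, sum_alternating_choose_eq_zero hL, zero_mul, sub_zero, Phi]
  refine Finset.sum_congr rfl fun l _ => ?_
  have : (0 : ℝ) ≤ l := l.cast_nonneg
  rw [posPow, if_pos (by linarith), sub_eq_neg_add]

lemma Phi_eq_zero {α u v : ℝ} {L : ℕ} (hu : (L : ℝ) ≤ u) : Phi α L u v = 0 := by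
  refine Finset.sum_eq_zero fun l hl => ?_
  have : (l : ℝ) ≤ L := by exact_mod_cast Finset.mem_range_succ_iff.1 hl
  rw [posPow, if_neg (by linarith), mul_zero]

lemma measurable_Phi (α : ℝ) (L : ℕ) (v : ℝ) : Measurable fun u => Phi α L u v := by
  unfold Phi posPow
  refine Finset.measurable_sum _ fun l _ => Measurable.const_mul ?_ _
  refine Measurable.ite ?_ (by fun_prop) measurable_const
  exact measurableSet_lt measurable_const (by fun_prop)

/-- A common envelope for `Phi` and its Lipschitz constant in `v`. -/
lemma exists_Phi_envelope {α Hlow Hup : ℝ} {L : ℕ} (hα : 1 < α) (hL : 1 ≤ L)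
    (h0 : 1 / α < Hlow) (h2 : Hup < 1) :
    ∃ C > (0 : ℝ), ∃ s > 1 / α, (∀ v ∈ Set.Icc Hlow Hup, ∀ u,
      |Phi α L u v| ≤ C * (1 + |u|) ^ (-s)) ∧
      ∀ v ∈ Set.Icc Hlow Hup, ∀ v' ∈ Set.Icc Hlow Hup, ∀ u,
        |Phi α L u v - Phi α L u v'| ≤ C * (1 + |u|) ^ (-s) * |v - v'| := by
  have hα0 : 0 < 1 / α := by positivity
  have hα1 : 1 / α < 1 := by rw [div_lt_one (by linarith)]; exact hα
  set k : ℝ := Hlow - 1 / α with hk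
  set K : ℝ := Hup - 1 / α with hKdef
  set ε : ℝ := (1 - Hup) / 2 with hεdef
  have hε : 0 < ε := by rw [hεdef]; linarith
  have hk0 : 0 < k := by rw [hk]; linarith
  have hKε : K + ε < 1 := by rw [hKdef, hεdef]; linarith
  set s : ℝ := 1 - K - ε with hs
  have hs0 : 1 / α < s := by rw [hs, hKdef, hεdef]; linarith
  have hs_pos : 0 < s := by linarith
  have hLR : (1 : ℝ) ≤ L := by exact_mod_cast hL
  set B : ℝ := L + 1 with hB
  have hB1 : 1 ≤ B := by linarith
  set D : ℝ := 2 ^ L * ((1 / k + B * B) + (|K| / ε + 1) * L) with hD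
  have hD0 : 0 < D := by positivity
  have hmem : ∀ v ∈ Set.Icc Hlow Hup, v - 1 / α ∈ Set.Icc k 1 ∧ v - 1 / α ∈ Set.Icc 0 K := by
    intro v hv
    have := hv.1
    have := hv.2
    refine ⟨⟨?_, ?_⟩, ⟨?_, ?_⟩⟩ <;> linarith
  have hfar : ∀ κ ∈ Set.Icc 0 K, ∀ κ' ∈ Set.Icc 0 K, ∀ u ≤ (-1 : ℝ),
      |∑ l ∈ Finset.range (L + 1), ((-1 : ℝ) ^ (L - l) * (L.choose l : ℝ)) *
        (((-u + l) ^ κ - (-u) ^ κ) - ((-u + l) ^ κ' - (-u) ^ κ'))| ≤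
        D * (-u) ^ (-s) * |κ - κ'| := by
    intro κ hκ κ' hκ' u hu
    have hK0 : 0 ≤ K := hκ.1.trans hκ.2
    have hu0 : 0 < -u := by linarith
    refine (abs_sum_mul_le (M := (K / ε + 1) * L * (-u) ^ (-s) * |κ - κ'|) ?_).trans ?_
    · intro l hl
      have hl' : (l : ℝ) ≤ L := by exact_mod_cast Finset.mem_range_succ_iff.1 hl
      refine (abs_rpow_increment_sub_le hε hKε hκ hκ' (by linarith) l.cast_nonneg).trans ?_
      have : K + ε - 1 = -s := by rw [hs]; ring
      rw [this]
      gcongr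
    · rw [sum_abs_alternating_choose, hD, abs_of_nonneg hK0]
      have hnn : 0 ≤ 2 ^ L * (1 / k + B * B) * ((-u) ^ (-s) * |κ - κ'|) := by positivity
      linarith
  have hnear : ∀ u : ℝ, -1 ≤ u → u ≤ L → (B + 1) ^ (-s) ≤ (1 + |u|) ^ (-s) := by
    intro u h₁ h₂
    refine Real.rpow_le_rpow_of_nonpos (by positivity) ?_ (by linarith)
    have : |u| ≤ B := abs_le.2 ⟨by linarith, by linarith⟩
    linarith
  have hfar' : ∀ u ≤ (-1 : ℝ), (-u) ^ (-s) ≤ 2 ^ s * (1 + |u|) ^ (-s) := by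
    intro u hu
    have hu0 : 0 < -u := by linarith
    rw [abs_of_neg (by linarith), show (2 : ℝ) ^ s = (1 / 2) ^ (-s) by
      rw [one_div, Real.inv_rpow zero_le_two, Real.rpow_neg zero_le_two, inv_inv],
      ← Real.mul_rpow (by norm_num) (by linarith)]
    exact Real.rpow_le_rpow_of_nonpos (by linarith) (by linarith) (by linarith)
  have hBs : 0 < (B + 1) ^ s := by positivity
  set E : ℝ := (2 ^ L * B + D) * ((B + 1) ^ s + 2 ^ s) with hE
  have hE₁ : ∀ u : ℝ, -1 ≤ u → u ≤ L → 2 ^ L * B + D ≤ E * (1 + |u|) ^ (-s) := by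
    intro u h₁ h₂
    have h₃ : 1 ≤ ((B + 1) ^ s + 2 ^ s) * (1 + |u|) ^ (-s) := by
      calc (1 : ℝ) = (B + 1) ^ s * (B + 1) ^ (-s) := by
            rw [← Real.rpow_add (by positivity), add_neg_cancel, Real.rpow_zero]
        _ ≤ _ := by
            refine mul_le_mul ?_ (hnear u h₁ h₂) (by positivity) (by positivity)
            exact le_add_of_nonneg_right (by positivity)
    rw [hE, mul_assoc]
    exact le_mul_of_one_le_right (by positivity) h₃
  have hE₂ : ∀ u ≤ (-1 : ℝ), D * (-u) ^ (-s) ≤ E * (1 + |u|) ^ (-s) := by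
    intro u hu
    calc D * (-u) ^ (-s) ≤ D * (2 ^ s * (1 + |u|) ^ (-s)) := by gcongr; exact hfar' u hu
      _ = D * 2 ^ s * (1 + |u|) ^ (-s) := by ring
      _ ≤ _ := by
          rw [hE]
          gcongr
          · exact le_add_of_nonneg_left (by positivity)
          · exact le_add_of_nonneg_left (by positivity)
  have hlB : ∀ u : ℝ, -1 ≤ u → ∀ l ∈ Finset.range (L + 1), (l : ℝ) - u ≤ B := by
    intro u hu l hl
    have : (l : ℝ) ≤ L := by exact_mod_cast Finset.mem_range_succ_iff.1 hl
    linarith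
  refine ⟨E, by positivity, s, hs0, ?_, ?_⟩
  · intro v hv u
    rcases le_total u (-1) with hu | hu
    · refine le_trans ?_ (hE₂ u hu)
      have hz : (0 : ℝ) ∈ Set.Icc 0 K :=
        ⟨le_rfl, (hmem v hv).2.1.trans (hmem v hv).2.2⟩
      have h := hfar _ (hmem v hv).2 0 hz u hu
      simp only [Real.rpow_zero, sub_self, sub_zero] at h
      rw [Phi_eq_sum_increment hL (by linarith)]
      refine h.trans (mul_le_of_le_one_right ?_ ?_)
      · have : 0 < -u := by linarith
        positivity
      · rw [abs_of_nonneg (hmem v hv).2.1]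
        exact (hmem v hv).1.2
    · rcases le_total u L with hu' | hu'
      · refine le_trans ?_ (hE₁ u hu hu')
        have h : |Phi α L u v| ≤ 2 ^ L * B := by
          rw [← sum_abs_alternating_choose]
          exact abs_sum_mul_le fun l hl => abs_posPow_le hB1 (hlB u hu l hl)
            ⟨hk0.le.trans (hmem v hv).1.1, (hmem v hv).1.2⟩
        linarith
      · rw [Phi_eq_zero hu', abs_zero]
        positivity
  · intro v hv v' hv' u
    have hvv : v - v' = (v - 1 / α) - (v' - 1 / α) := by ring
    rcases le_total u (-1) with hu | hu
    · refine le_trans ?_ (mul_le_mul_of_nonneg_right (hE₂ u hu) (abs_nonneg _))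
      have h := hfar _ (hmem v hv).2 _ (hmem v' hv').2 u hu
      rw [← hvv] at h
      rw [Phi_eq_sum_increment hL (by linarith), Phi_eq_sum_increment hL (by linarith),
        ← Finset.sum_sub_distrib]
      simpa only [← mul_sub] using h
    · rcases le_total u L with hu' | hu'
      · refine le_trans ?_ (mul_le_mul_of_nonneg_right (hE₁ u hu hu') (abs_nonneg _))
        have h : |Phi α L u v - Phi α L u v'| ≤ 2 ^ L * ((1 / k + B * B) * |v - v'|) := by
          rw [← sum_abs_alternating_choose, Phi, Phi, ← Finset.sum_sub_distrib, hvv]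
          simp only [← mul_sub]
          exact abs_sum_mul_le fun l hl => abs_posPow_sub_le hk0 hB1 (hlB u hu l hl)
            (hmem v hv).1 (hmem v' hv').1
        refine h.trans ?_
        rw [← mul_assoc]
        refine mul_le_mul_of_nonneg_right ?_ (abs_nonneg _)
        have h₁ : 0 ≤ (2 : ℝ) ^ L * B := by positivity
        have h₂ : 0 ≤ (2 : ℝ) ^ L * ((|K| / ε + 1) * L) := by positivity
        rw [hD]
        linarith
      · rw [Phi_eq_zero hu', Phi_eq_zero hu', sub_zero, abs_zero]
        positivity

lemma abs_rpow_sub_rpow_le {p M x y : ℝ} (hp : 1 ≤ p) (hx : x ∈ Set.Icc 0 M)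
    (hy : y ∈ Set.Icc 0 M) : |x ^ p - y ^ p| ≤ p * M ^ (p - 1) * |x - y| := by
  have hderiv : ∀ z ∈ Set.Icc 0 M, HasDerivWithinAt (fun z : ℝ => z ^ p)
      (p * z ^ (p - 1)) (Set.Icc 0 M) z := fun z _ =>
    (Real.hasDerivAt_rpow_const (Or.inr hp)).hasDerivWithinAt
  refine (convex_Icc 0 M).norm_image_sub_le_of_norm_hasDerivWithin_le hderiv
    (fun z hz => ?_) hy hx
  have := hz.1
  rw [Real.norm_of_nonneg (by positivity)]
  gcongr
  exact hz.2

lemma Phi_eq_rpow {α u v : ℝ} {L : ℕ} (hu : (L : ℝ) - 1 < u) (hu' : u < L) :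
    Phi α L u v = ((L : ℝ) - u) ^ (v - 1 / α) := by
  rw [Phi, Finset.sum_range_succ, Finset.sum_eq_zero, posPow, if_pos (by linarith)]
  · simp
  · intro l hl
    have : (l : ℝ) + 1 ≤ L := by exact_mod_cast Finset.mem_range.1 hl
    rw [posPow, if_neg (by linarith), mul_zero]

/-- The `α`-th power of the norm of `Phi` is bounded, bounded away from zero and Lipschitz. -/
lemma exists_integral_Phi_bounds {α Hlow Hup : ℝ} {L : ℕ} (hα : 1 < α) (hL : 1 ≤ L)
    (h0 : 1 / α < Hlow) (h2 : Hup < 1) :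
    ∃ a > (0 : ℝ), ∃ A : ℝ, ∀ v ∈ Set.Icc Hlow Hup,
      (∫ u : ℝ, |Phi α L u v| ^ α) ∈ Set.Icc a A ∧ ∀ v' ∈ Set.Icc Hlow Hup,
        |(∫ u : ℝ, |Phi α L u v| ^ α) - ∫ u : ℝ, |Phi α L u v'| ^ α| ≤ α * A * |v - v'| := by
  obtain ⟨C, hC, s, hs, hle, hlip⟩ := exists_Phi_envelope hα hL h0 h2
  have hα0 : 0 < α := by linarith
  set g : ℝ → ℝ := fun u => C * (1 + |u|) ^ (-s) with hg
  have hg0 : ∀ u, 0 < g u := fun u => by positivity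
  have hgint : Integrable fun u => g u ^ α := by
    have h : Integrable fun u : ℝ => (1 + ‖u‖) ^ (-(s * α)) := by
      refine integrable_one_add_norm ?_
      rw [Module.finrank_self, Nat.cast_one]
      exact (div_lt_iff₀ hα0).1 hs
    refine (h.const_mul (C ^ α)).congr (Filter.Eventually.of_forall fun u => ?_)
    simp only [hg, Real.norm_eq_abs]
    rw [Real.mul_rpow hC.le (by positivity), ← Real.rpow_mul (by positivity), neg_mul]
  have hint : ∀ v ∈ Set.Icc Hlow Hup, Integrable fun u => |Phi α L u v| ^ α := by
    intro v hv
    refine hgint.mono' ?_ (Filter.Eventually.of_forall fun u => ?_)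
    · exact (((measurable_Phi α L v).norm).pow_const α).aestronglyMeasurable
    · rw [Real.norm_of_nonneg (by positivity)]
      exact Real.rpow_le_rpow (abs_nonneg _) (hle v hv u) hα0.le
  refine ⟨(1 / 2) ^ α * (1 / 2), by positivity, ∫ u, g u ^ α, fun v hv => ⟨⟨?_, ?_⟩, ?_⟩⟩
  · have hsub : ∫ u in Set.Ioc ((L : ℝ) - 1) (L - 1 / 2), |Phi α L u v| ^ α ≤
        ∫ u : ℝ, |Phi α L u v| ^ α :=
      setIntegral_le_integral (hint v hv) (Filter.Eventually.of_forall fun u => by positivity)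
    refine le_trans ?_ hsub
    have hconst : ∫ _ in Set.Ioc ((L : ℝ) - 1) (L - 1 / 2), ((1 / 2 : ℝ)) ^ α =
        (1 / 2) ^ α * (1 / 2) := by
      rw [setIntegral_const, Real.volume_real_Ioc_of_le (by linarith), smul_eq_mul]
      ring
    rw [← hconst]
    refine setIntegral_mono_on (by simp) (hint v hv).integrableOn measurableSet_Ioc ?_
    intro u hu
    have hκ : v - 1 / α ∈ Set.Icc (0 : ℝ) 1 := by
      have : 0 < 1 / α := by positivity
      constructor <;> linarith [hv.1, hv.2]
    rw [Phi_eq_rpow hu.1 (by linarith [hu.2])]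
    refine Real.rpow_le_rpow (by norm_num) ((?_ : (1 / 2 : ℝ) ≤ _).trans (le_abs_self _)) hα0.le
    calc (1 / 2 : ℝ) = (1 / 2) ^ (1 : ℝ) := (Real.rpow_one _).symm
      _ ≤ (1 / 2) ^ (v - 1 / α) :=
        Real.rpow_le_rpow_of_exponent_ge (by norm_num) (by norm_num) hκ.2
      _ ≤ _ := Real.rpow_le_rpow (by norm_num) (by linarith [hu.2]) hκ.1
  · exact integral_mono (hint v hv) hgint fun u =>
      Real.rpow_le_rpow (abs_nonneg _) (hle v hv u) hα0.le
  · intro v' hv'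
    rw [← integral_sub (hint v hv) (hint v' hv'), ← Real.norm_eq_abs, mul_right_comm,
      ← integral_const_mul]
    refine norm_integral_le_of_norm_le (hgint.const_mul _)
      (Filter.Eventually.of_forall fun u => ?_)
    rw [Real.norm_eq_abs]
    refine (abs_rpow_sub_rpow_le hα.le ⟨abs_nonneg _, hle v hv u⟩
      ⟨abs_nonneg _, hle v' hv' u⟩).trans ?_
    have hpow : g u ^ α = g u ^ (α - 1) * g u := by
      rw [Real.rpow_sub_one (hg0 u).ne', div_mul_cancel₀ _ (hg0 u).ne']
    rw [hpow]
    calc α * g u ^ (α - 1) * |(|Phi α L u v| - |Phi α L u v'|)|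
        ≤ α * g u ^ (α - 1) * (g u * |v - v'|) := by
          have := hg0 u
          gcongr
          exact (abs_abs_sub_abs_le_abs_sub _ _).trans (hlip v hv v' hv' u)
      _ = _ := by ring

lemma exists_PhiNorm_rpow_bounds {α β Hlow Hup : ℝ} {L : ℕ} (hα : 1 < α) (hL : 1 ≤ L)
    (h0 : 1 / α < Hlow) (h2 : Hup < 1) (hβ : β ∈ Set.Ioc (0 : ℝ) 1) :
    ∃ m > (0 : ℝ), ∃ M > (0 : ℝ), ∃ C > (0 : ℝ), ∀ v ∈ Set.Icc Hlow Hup,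
      PhiNorm α L v ^ β ∈ Set.Icc m M ∧ ∀ v' ∈ Set.Icc Hlow Hup,
        PhiNorm α L v ^ β ≤ PhiNorm α L v' ^ β * (1 + C * |v - v'|) := by
  obtain ⟨a, ha, A, hA⟩ := exists_integral_Phi_bounds hα hL h0 h2
  have hα0 : 0 < α := by linarith
  set p : ℝ := 1 / α * β with hp
  have hp0 : 0 < p := mul_pos (by positivity) hβ.1
  have hp1 : p ≤ 1 :=
    mul_le_one₀ (by rw [div_le_one hα0]; exact hα.le) hβ.1.le hβ.2
  have hnorm : ∀ v, PhiNorm α L v ^ β = (∫ u : ℝ, |Phi α L u v| ^ α) ^ p := fun v =>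
    (Real.rpow_mul (integral_nonneg fun u => by positivity) _ _).symm
  refine ⟨a ^ p, by positivity, max A 1 ^ p, by positivity, α * max A 1 / a, by positivity,
    fun v hv => ?_⟩
  obtain ⟨hv₁, hv₂⟩ := hA v hv
  have hv₀ : 0 < ∫ u : ℝ, |Phi α L u v| ^ α := ha.trans_le hv₁.1
  simp only [hnorm]
  refine ⟨⟨Real.rpow_le_rpow ha.le hv₁.1 hp0.le,
    Real.rpow_le_rpow hv₀.le (hv₁.2.trans (le_max_left _ _)) hp0.le⟩, fun v' hv' => ?_⟩
  have hv'₁ := (hA v' hv').1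
  set J := ∫ u : ℝ, |Phi α L u v| ^ α
  set J' := ∫ u : ℝ, |Phi α L u v'| ^ α
  have hJ' : 0 < J' := ha.trans_le hv'₁.1
  set x : ℝ := α * max A 1 / a * |v - v'| with hx
  have hx0 : 0 ≤ x := by positivity
  have hJ : J ≤ J' * (1 + x) := by
    have h₁ := (le_abs_self _).trans (hv₂ v' hv')
    have h₂ : α * A * |v - v'| ≤ a * x := by
      rw [hx, ← mul_assoc, mul_div_cancel₀ _ ha.ne']
      gcongr
      exact le_max_left _ _
    have h₃ : a * x ≤ J' * x := mul_le_mul_of_nonneg_right hv'₁.1 hx0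
    linarith
  calc J ^ p ≤ (J' * (1 + x)) ^ p := Real.rpow_le_rpow hv₀.le hJ hp0.le
    _ = J' ^ p * (1 + x) ^ p := Real.mul_rpow hJ'.le (by positivity)
    _ ≤ J' ^ p * (1 + x) := by
      gcongr
      calc (1 + x) ^ p ≤ (1 + x) ^ (1 : ℝ) :=
            Real.rpow_le_rpow_of_exponent_le (by linarith) hp1
        _ = 1 + x := Real.rpow_one _

lemma sub_le_card_lattice_points {L N : ℕ} {a b : ℝ} (hN : 0 < N) (ha : 0 ≤ a) (hab : a ≤ b)
    (hb : b ≤ 1) : (b - a) * N - L - 1 ≤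
      (((Finset.range (N - L + 1)).filter fun k : ℕ => (k : ℝ) / N ∈ Set.Icc a b).card : ℝ) := by
  have hN' : (0 : ℝ) < N := by exact_mod_cast hN
  have hsub : Finset.Ico ⌈a * N⌉₊ (⌊b * N⌋₊ + 1 - L) ⊆
      (Finset.range (N - L + 1)).filter fun k : ℕ => (k : ℝ) / N ∈ Set.Icc a b := by
    intro k hk
    obtain ⟨hk₁, hk₂⟩ := Finset.mem_Ico.1 hk
    have hfloor : (⌊b * N⌋₊ : ℝ) ≤ b * N := Nat.floor_le (by have := ha.trans hab; positivity)
    have hle : ⌊b * N⌋₊ ≤ N := by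
      have : (⌊b * N⌋₊ : ℝ) ≤ N := hfloor.trans (mul_le_of_le_one_left hN'.le hb)
      exact_mod_cast this
    rw [Finset.mem_filter, Finset.mem_range]
    refine ⟨by lia, (le_div_iff₀ hN').2 (Nat.ceil_le.1 hk₁), (div_le_iff₀ hN').2 ?_⟩
    have : (k : ℝ) ≤ ⌊b * N⌋₊ := by
      have : k ≤ ⌊b * N⌋₊ := by lia
      exact_mod_cast this
    linarith
  have hcard := Finset.card_le_card hsub
  rw [Nat.card_Ico] at hcard
  set n := ((Finset.range (N - L + 1)).filter fun k : ℕ => (k : ℝ) / N ∈ Set.Icc a b).card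
  have h : (⌊b * N⌋₊ : ℝ) + 1 ≤ n + L + ⌈a * N⌉₊ := by
    have : ⌊b * N⌋₊ + 1 ≤ n + L + ⌈a * N⌉₊ := by lia
    exact_mod_cast this
  have h₁ := Nat.lt_floor_add_one (b * N)
  have h₂ := Nat.ceil_lt_add_one (a := a * N) (by positivity)
  linarith

/-- Inside `[u, w]` there is an interval of length `(w - u) * δ / 2` all of whose points are
`δ`-close to a given point `t`. -/
lemma exists_subinterval_near {u w t δ : ℝ} (hw : w - u ≤ 1) (ht : t ∈ Set.Icc u w)
    (hδ : δ ∈ Set.Ioc (0 : ℝ) 1) : ∃ a b : ℝ, u ≤ a ∧ a ≤ b ∧ b ≤ w ∧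
      b - a = (w - u) * δ / 2 ∧ ∀ x ∈ Set.Icc a b, |x - t| ≤ δ := by
  obtain ⟨h₁, h₂⟩ := ht
  obtain ⟨h₃, h₄⟩ := hδ
  have h₅ : 0 ≤ w - u := by linarith
  have h₆ : (w - u) * δ ≤ w - u := mul_le_of_le_one_right h₅ h₄
  have h₇ : (w - u) * δ ≤ δ := mul_le_of_le_one_left h₃.le hw
  have h₈ : 0 ≤ (w - u) * δ := by positivity
  rcases le_total t ((u + w) / 2) with h | h
  · refine ⟨t, t + (w - u) * δ / 2, h₁, by linarith, by linarith, by ring, fun x hx => ?_⟩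
    rw [abs_le]
    constructor <;> linarith [hx.1, hx.2]
  · refine ⟨t - (w - u) * δ / 2, t, by linarith, by linarith, h₂, by ring, fun x hx => ?_⟩
    rw [abs_le]
    constructor <;> linarith [hx.1, hx.2]

/-- The sum of `q (k / N) * N ^ (-(β * H (k / N)))` over an interval dominates the contribution
of each of its points, up to a factor of order `(w - u) * N / (log N) ^ 2`. -/
lemma mul_rpow_le_sum {L N : ℕ} {β cH ρ m u w t : ℝ} {H q : ℝ → ℝ}
    (hβ : β ∈ Set.Ioc (0 : ℝ) 1) (hcH : 0 < cH) (hρ : 1 / 2 ≤ ρ) (hm : 0 < m)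
    (hq : ∀ s ∈ Set.Icc (0 : ℝ) 1, m ≤ q s)
    (hHol : ∀ t₁ ∈ Set.Icc (0 : ℝ) 1, ∀ t₂ ∈ Set.Icc (0 : ℝ) 1,
      |H t₁ - H t₂| ≤ cH * |t₁ - t₂| ^ ρ)
    (hN : 0 < N) (hlog : 1 ≤ Real.log N) (hu : 0 ≤ u) (hw : w ≤ 1)
    (hlen : 4 * ((L : ℝ) + 1) * (Real.log N) ^ 2 / N ≤ w - u) (ht : t ∈ Set.Icc u w) :
    (w - u) * N / (4 * (Real.log N) ^ 2) *
        (m * Real.exp (-cH) * (N : ℝ) ^ (-(β * H t))) ≤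
      ∑ k ∈ (Finset.range (N - L + 1)).filter fun k : ℕ => (k : ℝ) / N ∈ Set.Icc u w,
        q ((k : ℝ) / N) * (N : ℝ) ^ (-(β * H ((k : ℝ) / N))) := by
  have hN' : (0 : ℝ) < N := by exact_mod_cast hN
  set ℓ := Real.log N with hℓ
  have hℓ0 : 0 < ℓ := by linarith
  have hδ : (1 / ℓ) ^ 2 ∈ Set.Ioc (0 : ℝ) 1 :=
    ⟨by positivity, pow_le_one₀ (by positivity) ((div_le_one hℓ0).2 hlog)⟩
  obtain ⟨a, b, hua, hab, hbw, hba, hnear⟩ :=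
    exists_subinterval_near (by linarith) ht hδ
  have ht01 : t ∈ Set.Icc (0 : ℝ) 1 := ⟨hu.trans ht.1, ht.2.trans hw⟩
  have hcard := sub_le_card_lattice_points (L := L) hN (hu.trans hua) hab (hbw.trans hw)
  have hcount : (w - u) * N / (4 * ℓ ^ 2) ≤ (b - a) * N - L - 1 := by
    rw [hba]
    have h₁ : (L : ℝ) + 1 ≤ (w - u) * N / (4 * ℓ ^ 2) := by
      rw [le_div_iff₀ (by positivity)]
      rw [div_le_iff₀ hN'] at hlen
      linarith
    have h₂ : (w - u) * (1 / ℓ) ^ 2 / 2 * N = 2 * ((w - u) * N / (4 * ℓ ^ 2)) := by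
      field_simp
      norm_num
    linarith
  set s := (Finset.range (N - L + 1)).filter fun k : ℕ => (k : ℝ) / N ∈ Set.Icc a b with hs
  have hsub : s ⊆ (Finset.range (N - L + 1)).filter fun k : ℕ => (k : ℝ) / N ∈ Set.Icc u w :=
    Finset.monotone_filter_right _ fun k _ hk => ⟨hua.trans hk.1, hk.2.trans hbw⟩
  have hmem : ∀ x ∈ Set.Icc u w, x ∈ Set.Icc (0 : ℝ) 1 := fun x hx =>
    ⟨hu.trans hx.1, hx.2.trans hw⟩
  have hterm : ∀ x ∈ Set.Icc a b,
      m * Real.exp (-cH) * (N : ℝ) ^ (-(β * H t)) ≤ q x * (N : ℝ) ^ (-(β * H x)) := by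
    intro x hx
    have hx01 := hmem x ⟨hua.trans hx.1, hx.2.trans hbw⟩
    rw [mul_assoc, Real.rpow_def_of_pos hN', Real.rpow_def_of_pos hN', ← Real.exp_add, ← hℓ]
    refine mul_le_mul (hq x hx01) (Real.exp_le_exp.2 ?_) (Real.exp_pos _).le
      (hm.le.trans (hq x hx01))
    have h₁ : |x - t| ^ ρ ≤ 1 / ℓ := by
      calc |x - t| ^ ρ ≤ ((1 / ℓ) ^ 2) ^ ρ :=
            Real.rpow_le_rpow (abs_nonneg _) (hnear x hx) (by linarith)
        _ ≤ ((1 / ℓ) ^ 2) ^ (1 / 2 : ℝ) :=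
            Real.rpow_le_rpow_of_exponent_ge hδ.1 hδ.2 hρ
        _ = 1 / ℓ := by rw [← Real.sqrt_eq_rpow, Real.sqrt_sq (by positivity)]
    have h₂ : |H x - H t| ≤ cH * (1 / ℓ) :=
      (hHol x hx01 t ht01).trans (by gcongr)
    have h₃ : ℓ * β * (H x - H t) ≤ cH := by
      calc ℓ * β * (H x - H t) ≤ ℓ * 1 * (cH * (1 / ℓ)) := by
            have h₄ := (le_abs_self _).trans h₂
            have h₅ : ℓ * β ≤ ℓ * 1 := mul_le_mul_of_nonneg_left hβ.2 hℓ0.le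
            have h₆ : 0 < ℓ * β := mul_pos hℓ0 hβ.1
            exact (mul_le_mul_of_nonneg_left h₄ h₆.le).trans
              (mul_le_mul_of_nonneg_right h₅ (by positivity))
        _ = cH := by field_simp
    linarith
  have hconst : 0 < m * Real.exp (-cH) * (N : ℝ) ^ (-(β * H t)) := by positivity
  calc (w - u) * N / (4 * ℓ ^ 2) * (m * Real.exp (-cH) * (N : ℝ) ^ (-(β * H t)))
      ≤ s.card * (m * Real.exp (-cH) * (N : ℝ) ^ (-(β * H t))) := by
        gcongr
        exact hcount.trans hcard
    _ = ∑ k ∈ s, m * Real.exp (-cH) * (N : ℝ) ^ (-(β * H t)) := by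
        rw [Finset.sum_const, nsmul_eq_mul]
    _ ≤ ∑ k ∈ s, q ((k : ℝ) / N) * (N : ℝ) ^ (-(β * H ((k : ℝ) / N))) :=
        Finset.sum_le_sum fun k hk => hterm _ (Finset.mem_filter.1 hk).2
    _ ≤ _ := by
        refine Finset.sum_le_sum_of_subset_of_nonneg hsub fun k hk _ => ?_
        have := hm.le.trans (hq _ (hmem _ (Finset.mem_filter.1 hk).2))
        positivity

lemma rpow_neg_mul_log_le_two {ρ x : ℝ} (hρ : 1 / 2 ≤ ρ) (hx : 0 < x) :
    x ^ (-ρ) * Real.log x ≤ 2 := by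
  calc x ^ (-ρ) * Real.log x ≤ x ^ (-ρ) * (x ^ ρ / ρ) := by
        gcongr
        exact Real.log_le_rpow_div hx.le (by linarith)
    _ = 1 / ρ := by rw [← mul_div_assoc, ← Real.rpow_add hx, neg_add_cancel, Real.rpow_zero]
    _ ≤ 2 := by rw [div_le_iff₀ (by linarith)]; linarith

/-- Neighbouring terms of the sums at scale `2 * N` differ by a relative error of order
`N ^ (-ρ) * log N`. -/
lemma mul_rpow_le_mul_rpow_neighbour {N : ℕ} {β cH ρ C s t : ℝ} {H q : ℝ → ℝ}
    (hβ : β ∈ Set.Ioc (0 : ℝ) 1) (hcH : 0 < cH) (hρ : 1 / 2 ≤ ρ) (hC : 0 < C)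
    (hqs : 0 ≤ q s) (hqt : q t ≤ q s * (1 + C * |H t - H s|))
    (hHol : |H t - H s| ≤ cH * |t - s| ^ ρ) (hts : |t - s| ≤ (N : ℝ)⁻¹)
    (hN : 4 ≤ N) (hlog : 1 ≤ Real.log N) :
    q t * (2 * (N : ℝ)) ^ (-(β * H t)) ≤ q s * (2 * (N : ℝ)) ^ (-(β * H s)) *
      (1 + (C * cH + 2 * cH * Real.exp (4 * cH) +
        2 * (C * cH) * (2 * cH * Real.exp (4 * cH))) * ((N : ℝ) ^ (-ρ) * Real.log N)) := by
  have hN4 : (4 : ℝ) ≤ N := by exact_mod_cast hN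
  have hN' : (0 : ℝ) < N := by linarith
  set ℓ := Real.log N with hℓ
  set η := (N : ℝ) ^ (-ρ) * ℓ with hη
  have hNρ : 0 < (N : ℝ) ^ (-ρ) := by positivity
  have hη0 : 0 ≤ η := by positivity
  have hη2 : η ≤ 2 := rpow_neg_mul_log_le_two hρ hN'
  have hd : |H t - H s| ≤ cH * (N : ℝ) ^ (-ρ) := by
    refine hHol.trans ?_
    rw [Real.rpow_neg hN'.le, ← Real.inv_rpow hN'.le]
    gcongr
  have hdη : |H t - H s| ≤ cH * η :=
    hd.trans (mul_le_mul_of_nonneg_left (le_mul_of_one_le_right hNρ.le hlog) hcH.le)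
  have hlog2 : Real.log (2 * N) ≤ 2 * ℓ := by
    rw [Real.log_mul two_ne_zero hN'.ne', two_mul]
    gcongr
    exact Real.log_le_log two_pos (by linarith)
  have hlog2' : 0 ≤ Real.log (2 * N) := Real.log_nonneg (by linarith)
  set y := 2 * cH * η with hy
  have hy0 : 0 ≤ y := by positivity
  have hexp : Real.exp y ≤ 1 + 2 * cH * Real.exp (4 * cH) * η := by
    have h₁ : 1 - y ≤ Real.exp (-y) := by linarith [Real.add_one_le_exp (-y)]
    have h₂ : (1 - y) * Real.exp y ≤ 1 := by
      calc (1 - y) * Real.exp y ≤ Real.exp (-y) * Real.exp y := by gcongr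
        _ = 1 := by rw [← Real.exp_add, neg_add_cancel, Real.exp_zero]
    have h₃ : y * Real.exp y ≤ y * Real.exp (4 * cH) := by
      gcongr
      rw [hy]
      nlinarith
    calc Real.exp y ≤ 1 + y * Real.exp (4 * cH) := by linarith
      _ = _ := by rw [hy]; ring
  have hpow : (2 * (N : ℝ)) ^ (-(β * H t)) ≤ (2 * (N : ℝ)) ^ (-(β * H s)) * Real.exp y := by
    rw [Real.rpow_def_of_pos (by positivity), Real.rpow_def_of_pos (by positivity),
      ← Real.exp_add]
    refine Real.exp_le_exp.2 ?_
    have h₁ : Real.log (2 * N) * β * (H s - H t) ≤ y := by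
      calc Real.log (2 * N) * β * (H s - H t) ≤ Real.log (2 * N) * 1 * |H t - H s| := by
            have h₂ : H s - H t ≤ |H t - H s| := by rw [abs_sub_comm]; exact le_abs_self _
            have h₃ : 0 ≤ Real.log (2 * N) * β := mul_nonneg hlog2' hβ.1.le
            exact (mul_le_mul_of_nonneg_left h₂ h₃).trans
              (mul_le_mul_of_nonneg_right (mul_le_mul_of_nonneg_left hβ.2 hlog2')
                (abs_nonneg _))
        _ ≤ 2 * ℓ * (cH * (N : ℝ) ^ (-ρ)) := by
            rw [mul_one]
            gcongr
        _ = y := by rw [hy, hη]; ring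
    linarith
  set P := (2 * (N : ℝ)) ^ (-(β * H s)) with hP
  have hP0 : 0 < P := by positivity
  set D := 2 * cH * Real.exp (4 * cH) with hD
  have hD0 : 0 < D := by positivity
  have h1 : q t ≤ q s * (1 + C * cH * η) := by
    refine hqt.trans (mul_le_mul_of_nonneg_left ?_ hqs)
    rw [mul_assoc]
    gcongr
  calc q t * (2 * (N : ℝ)) ^ (-(β * H t))
      ≤ (q s * (1 + C * cH * η)) * (P * (1 + D * η)) := by
        refine mul_le_mul h1 (hpow.trans ?_) (by positivity) (by positivity)
        gcongr
    _ = q s * P * (1 + (C * cH + D + C * cH * D * η) * η) := by ring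
    _ ≤ q s * P * (1 + (C * cH + D + C * cH * D * 2) * η) := by gcongr
    _ = _ := by ring

lemma abs_sum_sub_sum_le {ι : Type*} [DecidableEq ι] {s t : Finset ι} {g : ι → ℝ} {R : ℝ}
    (hs : ∀ i ∈ s, |g i| ≤ R) (ht : ∀ i ∈ t, |g i| ≤ R) :
    |∑ i ∈ s, g i - ∑ i ∈ t, g i| ≤ ((s \ t).card + (t \ s).card) * R := by
  rw [← Finset.sum_sdiff_sub_sum_sdiff]
  have hbound : ∀ r : Finset ι, (∀ i ∈ r, |g i| ≤ R) → |∑ i ∈ r, g i| ≤ r.card * R := by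
    intro r hr
    refine (Finset.abs_sum_le_sum_abs _ _).trans ?_
    rw [← nsmul_eq_mul]
    exact Finset.sum_le_card_nsmul _ _ _ hr
  have h₁ := hbound (s \ t) fun i hi => hs i (Finset.mem_sdiff.1 hi).1
  have h₂ := hbound (t \ s) fun i hi => ht i (Finset.mem_sdiff.1 hi).1
  have h₃ := abs_sub (∑ i ∈ s \ t, g i) (∑ i ∈ t \ s, g i)
  linarith

lemma sum_biUnion_double (ν : Finset ℕ) (g : ℕ → ℝ) :
    ∑ m ∈ ν.biUnion (fun k => {2 * k, 2 * k + 1}), g m =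
      ∑ k ∈ ν, (g (2 * k) + g (2 * k + 1)) := by
  rw [Finset.sum_biUnion]
  · exact Finset.sum_congr rfl fun k _ => Finset.sum_pair (by lia)
  · intro i _ j _ hij
    simp only [Function.onFun, Finset.disjoint_left, Finset.mem_insert, Finset.mem_singleton]
    lia

lemma card_sdiff_biUnion_double_le {L N : ℕ} {u w : ℝ} (hL : 1 ≤ L) (hN : 0 < N) :
    (((Finset.range (2 * N - L + 1)).filter fun m : ℕ => (m : ℝ) / (2 * N) ∈ Set.Icc u w) \
      ((Finset.range (N - L + 1)).filter fun k : ℕ => (k : ℝ) / N ∈ Set.Icc u w).biUnion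
        (fun k => {2 * k, 2 * k + 1})).card ≤ L := by
  have hN' : (0 : ℝ) < N := by exact_mod_cast hN
  have hsub : ((Finset.range (2 * N - L + 1)).filter fun m : ℕ =>
      (m : ℝ) / (2 * N) ∈ Set.Icc u w) \
      ((Finset.range (N - L + 1)).filter fun k : ℕ => (k : ℝ) / N ∈ Set.Icc u w).biUnion
        (fun k => {2 * k, 2 * k + 1}) ⊆
      insert (2 * ⌈u * N⌉₊ - 1) (Finset.Ico (2 * (N - L + 1)) (2 * N - L + 1)) := by
    intro m hm
    simp only [Finset.mem_sdiff, Finset.mem_filter, Finset.mem_range, Finset.mem_biUnion,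
      Finset.mem_insert, Finset.mem_singleton, not_exists, not_and] at hm
    obtain ⟨⟨hm₁, hm₂, hm₃⟩, hm₄⟩ := hm
    rw [le_div_iff₀ (by positivity)] at hm₂
    rw [div_le_iff₀ (by positivity)] at hm₃
    rw [Finset.mem_insert, Finset.mem_Ico]
    by_contra! hcon
    obtain ⟨hcon₁, hcon₂⟩ := hcon
    have hhalf : 2 * ((m / 2 : ℕ) : ℝ) ≤ m := by exact_mod_cast Nat.mul_div_le m 2
    have hceil : 2 * ⌈u * N⌉₊ < m + 2 := by
      rcases Nat.eq_zero_or_pos ⌈u * N⌉₊ with h | h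
      · lia
      · have h₁ : u * N ≤ (m : ℝ) / 2 := by linarith
        have h₂ : 0 < u * N := Nat.ceil_pos.1 h
        have h₃ := Nat.ceil_lt_add_one h₂.le
        have h₄ : (2 * ⌈u * N⌉₊ : ℝ) < m + 2 := by linarith
        exact_mod_cast h₄
    refine hm₄ (m / 2) ⟨by lia, ?_, ?_⟩ (by lia)
    · rw [le_div_iff₀ hN', ← Nat.ceil_le]
      lia
    · rw [div_le_iff₀ hN']
      linarith
  refine (Finset.card_le_card hsub).trans ((Finset.card_insert_le _ _).trans ?_)
  rw [Nat.card_Ico]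
  lia

lemma card_biUnion_double_sdiff_le {L N : ℕ} {u w : ℝ} (hL : 1 ≤ L) (hN : 0 < N)
    (hLN : L ≤ N) :
    (((Finset.range (N - L + 1)).filter fun k : ℕ => (k : ℝ) / N ∈ Set.Icc u w).biUnion
        (fun k => {2 * k, 2 * k + 1}) \
      ((Finset.range (2 * N - L + 1)).filter fun m : ℕ =>
        (m : ℝ) / (2 * N) ∈ Set.Icc u w)).card ≤ 1 := by
  have hN' : (0 : ℝ) < N := by exact_mod_cast hN
  refine (Finset.card_le_card (t := {2 * ⌊w * N⌋₊ + 1}) ?_).trans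
    (Finset.card_singleton _).le
  intro m hm
  simp only [Finset.mem_sdiff, Finset.mem_filter, Finset.mem_range, Finset.mem_biUnion,
    Finset.mem_insert, Finset.mem_singleton, not_and] at hm ⊢
  obtain ⟨⟨k, ⟨hk₁, hk₂, hk₃⟩, hmk⟩, hm₂⟩ := hm
  rw [le_div_iff₀ hN'] at hk₂
  rw [div_le_iff₀ hN'] at hk₃
  have hm₃ := hm₂ (by lia)
  rw [Set.mem_Icc, le_div_iff₀ (by positivity), div_le_iff₀ (by positivity), not_and] at hm₃
  rcases hmk with rfl | rfl
  · push_cast at hm₃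
    exact absurd (by linarith) (hm₃ (by linarith))
  · push_cast at hm₃
    have hm₄ := hm₃ (by linarith)
    rw [(Nat.floor_eq_iff (k.cast_nonneg.trans hk₃)).2 ⟨hk₃, by linarith⟩]

lemma abs_div_sub_mul_div_le {W S T G n n₂ r e c : ℝ} (hS : 0 < S) (hr : 0 ≤ r) (hc : 0 ≤ c)
    (he : 0 ≤ e) (hn₂ : 0 ≤ n₂) (hT : 0 ≤ T) (hTr : T ≤ n₂ * (r * S))
    (hTG : |T - G| ≤ c * (r * S)) (hGW : |G - 2 * W| ≤ e * S) (hn : |n₂ - 2 * n| ≤ c) :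
    |W / S - n / n₂ * (T / S)| ≤ e + c * r := by
  have hratio : |(1 / 2 - n / n₂) * T| ≤ c * (r * S) / 2 := by
    rcases hn₂.eq_or_lt with rfl | h
    · rw [zero_mul] at hTr
      rw [le_antisymm hTr hT, mul_zero, abs_zero]
      positivity
    · have heq : 1 / 2 - n / n₂ = (n₂ - 2 * n) / (2 * n₂) := by field_simp
      rw [heq, abs_mul, abs_div, abs_of_pos (by positivity : 0 < 2 * n₂), abs_of_nonneg hT]
      calc |n₂ - 2 * n| / (2 * n₂) * T ≤ c / (2 * n₂) * (n₂ * (r * S)) := by gcongr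
        _ = c * (r * S) / 2 := by field_simp
  have h₁ : W / S - n / n₂ * (T / S) =
      (-((G - 2 * W) / 2) - (T - G) / 2 + (1 / 2 - n / n₂) * T) / S := by ring
  rw [h₁, abs_div, abs_of_pos hS, div_le_iff₀ hS]
  have h₂ : 0 ≤ e * S := by positivity
  rw [abs_le] at hTG hratio hGW ⊢
  constructor <;> linarith [hTG.1, hTG.2, hratio.1, hratio.2, hGW.1, hGW.2]

/-- With `S_N(I) = Σ_{k∈ν_N(I)} ‖Φ_α(·,H(k/N))‖^β N^{−βH(k/N)}`,
`W_N(I) = Σ_{k∈ν_N(I)} ‖Φ_α(·,H(k/N))‖^β (2N)^{−βH(k/N)}` and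
`T_{2N}(I) = Σ_{m∈ν_{2N}(I)} ‖Φ_α(·,H(m/2N))‖^β (2N)^{−βH(m/2N)}`, there is
`c > 0` (not depending on `I` and `N`) such that for every compact interval
`I = [u,w] ⊆ [0,1]` and every `N ≥ 4` with `λ(I) ≥ 4(L+1)N^{−1}(log N)²`,
`|W_N(I)/S_N(I) − (|ν_N(I)|/|ν_{2N}(I)|)·(T_{2N}(I)/S_N(I))|
  ≤ c·N^{−βρ_H}(log N)³ + c·λ(I)^{−1}N^{−1}(log N)²`. -/
theorem expectation_ratio_comparison (α : ℝ)
    (hα : α ∈ Set.Ioo (1 : ℝ) 2) (L : ℕ) (hL : 2 ≤ L) (β : ℝ)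
    (hβ : β ∈ Set.Ioc (0 : ℝ) (1 / 4)) (Hlow Hup : ℝ) (h0 : 1 / α < Hlow)
    (h1 : Hlow ≤ Hup) (h2 : Hup < 1) (H : ℝ → ℝ)
    (hH : ∀ t ∈ Set.Icc (0 : ℝ) 1, H t ∈ Set.Icc Hlow Hup) (cH ρ : ℝ)
    (hcH : 0 < cH) (hρ0 : Hup < ρ) (hρ1 : ρ ≤ 1)
    (hHol : ∀ t₁ ∈ Set.Icc (0 : ℝ) 1, ∀ t₂ ∈ Set.Icc (0 : ℝ) 1,
      |H t₁ - H t₂| ≤ cH * |t₁ - t₂| ^ ρ) :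
    ∃ c > (0 : ℝ), ∀ u w : ℝ, 0 ≤ u → u < w → w ≤ 1 → ∀ N : ℕ, 4 ≤ N →
      4 * ((L : ℝ) + 1) * (Real.log N) ^ 2 / N ≤ w - u →
      let ν : Finset ℕ :=
        (Finset.range (N - L + 1)).filter fun k => (k : ℝ) / N ∈ Set.Icc u w
      let ν2 : Finset ℕ :=
        (Finset.range (2 * N - L + 1)).filter fun m =>
          (m : ℝ) / (2 * N) ∈ Set.Icc u w
      let S := ∑ k ∈ ν, PhiNorm α L (H ((k : ℝ) / N)) ^ β *
        (N : ℝ) ^ (-(β * H ((k : ℝ) / N)))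
      let W := ∑ k ∈ ν, PhiNorm α L (H ((k : ℝ) / N)) ^ β *
        (2 * (N : ℝ)) ^ (-(β * H ((k : ℝ) / N)))
      let T := ∑ m ∈ ν2, PhiNorm α L (H ((m : ℝ) / (2 * N))) ^ β *
        (2 * (N : ℝ)) ^ (-(β * H ((m : ℝ) / (2 * N))))
      |W / S - ((ν.card : ℝ) / (ν2.card : ℝ)) * (T / S)| ≤
        c * (N : ℝ) ^ (-(β * ρ)) * (Real.log N) ^ 3 +
          c * (w - u)⁻¹ * (N : ℝ)⁻¹ * (Real.log N) ^ 2 := by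
  have hα1 : 1 < α := hα.1
  have hαpos : 0 < 1 / α := one_div_pos.2 (by linarith)
  have hL1 : 1 ≤ L := by lia
  have hβ1 : β ∈ Set.Ioc (0 : ℝ) 1 := ⟨hβ.1, hβ.2.trans (by norm_num)⟩
  have hρ : 1 / 2 ≤ ρ := by
    have : 1 / 2 < 1 / α := one_div_lt_one_div_of_lt (by linarith) hα.2
    linarith
  obtain ⟨m, hm, M, hM, C, hC, hq⟩ := exists_PhiNorm_rpow_bounds hα1 hL1 h0 h2 hβ1
  set q : ℝ → ℝ := fun t => PhiNorm α L (H t) ^ β with hqdef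
  have hqm : ∀ t ∈ Set.Icc (0 : ℝ) 1, m ≤ q t := fun t ht => (hq _ (hH t ht)).1.1
  have hqM : ∀ t ∈ Set.Icc (0 : ℝ) 1, q t ≤ M := fun t ht => (hq _ (hH t ht)).1.2
  set K : ℝ := C * cH + 2 * cH * Real.exp (4 * cH) +
    2 * (C * cH) * (2 * cH * Real.exp (4 * cH)) with hK
  have hK0 : 0 < K := by positivity
  set c₂ : ℝ := 4 * M * Real.exp cH / m with hc₂
  have hc₂0 : 0 < c₂ := by positivity
  set c₃ : ℝ := (L + 1) * ((1 + 2 * K) * c₂) with hc₃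
  refine ⟨K + c₃, by positivity, ?_⟩
  intro u w hu huw hw N hN hlen ν ν2 S W T
  have hN4 : (4 : ℝ) ≤ N := by exact_mod_cast hN
  have hNpos : 0 < N := by lia
  have hN' : (0 : ℝ) < N := by linarith
  have hlog : 1 ≤ Real.log N := by
    rw [Real.le_log_iff_exp_le hN']
    linarith [Real.exp_one_lt_d9]
  have hLN : L ≤ N := by
    rw [div_le_iff₀ hN'] at hlen
    have h₁ : (1 : ℝ) ≤ Real.log N ^ 2 := one_le_pow₀ hlog
    have h₂ : (w - u) * N ≤ N := mul_le_of_le_one_left hN'.le (by linarith)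
    have h₃ : 4 * ((L : ℝ) + 1) * 1 ≤ 4 * ((L : ℝ) + 1) * Real.log N ^ 2 := by gcongr
    have h₄ : (L : ℝ) ≤ N := by linarith [(L.cast_nonneg : (0 : ℝ) ≤ L)]
    exact_mod_cast h₄
  have hI : ∀ t ∈ Set.Icc u w, t ∈ Set.Icc (0 : ℝ) 1 := fun t ht =>
    ⟨hu.trans ht.1, ht.2.trans hw⟩
  set ℓ := Real.log N with hℓ
  have hℓ0 : 0 < ℓ := by linarith
  set X : ℝ := (w - u)⁻¹ * (N : ℝ)⁻¹ * ℓ ^ 2 with hX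
  have hwu : 0 < w - u := by linarith
  have hX0 : 0 < X := by positivity
  set η : ℝ := (N : ℝ) ^ (-ρ) * ℓ with hη
  have hη0 : 0 < η := by positivity
  have hη2 : η ≤ 2 := rpow_neg_mul_log_le_two hρ hN'
  set F : ℝ → ℝ := fun t => q t * (2 * (N : ℝ)) ^ (-(β * H t)) with hF
  have hF0 : ∀ t ∈ Set.Icc (0 : ℝ) 1, 0 < F t := fun t ht =>
    mul_pos (hm.trans_le (hqm t ht)) (by positivity)
  have hscale : ∀ t ∈ Set.Icc (0 : ℝ) 1,
      (2 * (N : ℝ)) ^ (-(β * H t)) ≤ (N : ℝ) ^ (-(β * H t)) := by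
    intro t ht
    refine Real.rpow_le_rpow_of_nonpos hN' (by linarith) ?_
    have : 0 < H t := by linarith [(hH t ht).1]
    have := mul_pos hβ.1 this
    linarith
  have hFS : ∀ t ∈ Set.Icc u w, F t ≤ c₂ * X * S := by
    intro t ht
    have h := mul_rpow_le_sum (L := L) hβ1 hcH hρ hm hqm hHol hNpos hlog hu hw hlen ht
    change _ ≤ S at h
    calc F t ≤ M * (N : ℝ) ^ (-(β * H t)) :=
          mul_le_mul (hqM t (hI t ht)) (hscale t (hI t ht)) (by positivity) hM.le
      _ = c₂ * X * ((w - u) * N / (4 * ℓ ^ 2) *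
            (m * Real.exp (-cH) * (N : ℝ) ^ (-(β * H t)))) := by
          rw [hc₂, hX, Real.exp_neg]
          field_simp
      _ ≤ c₂ * X * S := by gcongr
  have hν : ∀ k ∈ ν, (k : ℝ) / N ∈ Set.Icc u w := fun k hk => (Finset.mem_filter.1 hk).2
  have hW : W = ∑ k ∈ ν, F ((k : ℝ) / N) := rfl
  have hWS : W ≤ S := Finset.sum_le_sum fun k hk =>
    mul_le_mul_of_nonneg_left (hscale _ (hI _ (hν k hk)))
      (hm.le.trans (hqm _ (hI _ (hν k hk))))
  have hneigh : ∀ s ∈ Set.Icc (0 : ℝ) 1, ∀ t ∈ Set.Icc (0 : ℝ) 1, |t - s| ≤ (N : ℝ)⁻¹ →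
      F t ≤ F s * (1 + K * η) := fun s hs t ht hts =>
    mul_rpow_le_mul_rpow_neighbour hβ1 hcH hρ hC (hm.le.trans (hqm s hs))
      ((hq _ (hH t ht)).2 _ (hH s hs)) (hHol t ht s hs) hts hN hlog
  clear_value S W X η K c₂
  have hS : 0 < S := by
    have h := (hF0 u (hI u ⟨le_rfl, huw.le⟩)).trans_le (hFS u ⟨le_rfl, huw.le⟩)
    exact pos_of_mul_pos_right h (by positivity)
  set R : ℝ := (1 + 2 * K) * c₂ * X * S with hR
  have hR0 : 0 < R := by positivity
  have hFR : ∀ t ∈ Set.Icc u w, F t ≤ R := fun t ht => by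
    refine (hFS t ht).trans ?_
    have : 0 ≤ 2 * K * (c₂ * X * S) := by positivity
    linarith
  set B : Finset ℕ := ν.biUnion fun k => {2 * k, 2 * k + 1} with hB
  set g : ℕ → ℝ := fun i => F ((i : ℝ) / (2 * N)) with hg
  have heven : ∀ k : ℕ, g (2 * k) = F ((k : ℝ) / N) := by
    intro k
    simp only [hg]
    congr 1
    push_cast
    field_simp
  have hodd : ∀ k ∈ ν, ((2 * k + 1 : ℕ) : ℝ) / (2 * N) ∈ Set.Icc (0 : ℝ) 1 ∧
      |((2 * k + 1 : ℕ) : ℝ) / (2 * N) - (k : ℝ) / N| ≤ (N : ℝ)⁻¹ := by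
    intro k hk
    have hk' : 2 * k + 1 ≤ 2 * N := by
      have := Finset.mem_range.1 (Finset.mem_filter.1 hk).1
      lia
    refine ⟨⟨by positivity, ?_⟩, ?_⟩
    · rw [div_le_one (by positivity)]
      exact_mod_cast hk'
    · have : ((2 * k + 1 : ℕ) : ℝ) / (2 * N) - (k : ℝ) / N = (N : ℝ)⁻¹ / 2 := by
        push_cast
        field_simp
        ring
      rw [this, abs_of_pos (by positivity)]
      exact half_le_self (by positivity)
  have hgν2 : ∀ i ∈ ν2, |g i| ≤ R := by
    intro i hi
    have hi' := (Finset.mem_filter.1 hi).2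
    rw [abs_of_pos (hF0 _ (hI _ hi'))]
    exact hFR _ hi'
  have hgB : ∀ i ∈ B, |g i| ≤ R := by
    intro i hi
    obtain ⟨k, hk, hik⟩ := Finset.mem_biUnion.1 hi
    rw [Finset.mem_insert, Finset.mem_singleton] at hik
    have hk' := hν k hk
    rcases hik with rfl | rfl
    · rw [heven, abs_of_pos (hF0 _ (hI _ hk'))]
      exact hFR _ hk'
    · obtain ⟨ho₁, ho₂⟩ := hodd k hk
      rw [abs_of_pos (hF0 _ ho₁)]
      refine (hneigh _ (hI _ hk') _ ho₁ ho₂).trans ?_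
      have h₁ := hF0 _ (hI _ hk')
      calc F ((k : ℝ) / N) * (1 + K * η) ≤ c₂ * X * S * (1 + K * 2) := by
            gcongr
            exact hFS _ hk'
        _ = R := by rw [hR]; ring
  have hcard : (((ν2 \ B).card + (B \ ν2).card : ℝ)) ≤ L + 1 := by
    have h₁ : (ν2 \ B).card ≤ L := card_sdiff_biUnion_double_le hL1 hNpos
    have h₂ : (B \ ν2).card ≤ 1 := card_biUnion_double_sdiff_le hL1 hNpos hLN
    exact_mod_cast add_le_add h₁ h₂
  have hTB : |T - ∑ i ∈ B, g i| ≤ (L + 1) * R :=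
    (abs_sum_sub_sum_le hgν2 hgB).trans (mul_le_mul_of_nonneg_right hcard hR0.le)
  have hBW : |∑ i ∈ B, g i - 2 * W| ≤ K * η * S := by
    rw [hB, sum_biUnion_double, hW, Finset.mul_sum, ← Finset.sum_sub_distrib]
    refine (Finset.abs_sum_le_sum_abs _ _).trans ?_
    refine le_trans ?_ (mul_le_mul_of_nonneg_left hWS (by positivity : 0 ≤ K * η))
    rw [hW, Finset.mul_sum]
    refine Finset.sum_le_sum fun k hk => ?_
    have hk' := hI _ (hν k hk)
    obtain ⟨ho₁, ho₂⟩ := hodd k hk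
    have h₁ := hneigh _ hk' _ ho₁ ho₂
    have h₂ := hneigh _ ho₁ _ hk' (by rwa [abs_sub_comm])
    change g (2 * k + 1) ≤ _ at h₁
    change _ ≤ g (2 * k + 1) * _ at h₂
    have h₃ := hF0 _ hk'
    have h₄ : 0 < K * η := by positivity
    rw [heven, abs_le]
    constructor
    · by_contra! hcon
      have h₅ : g (2 * k + 1) < F ((k : ℝ) / N) * (1 - K * η) := by linarith
      have h₆ := mul_lt_mul_of_pos_right h₅ (by positivity : 0 < 1 + K * η)
      have h₇ : 0 ≤ F ((k : ℝ) / N) * (K * η) ^ 2 := by positivity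
      linarith
    · linarith
  have hcards : |(ν2.card : ℝ) - 2 * ν.card| ≤ L + 1 := by
    have h := abs_sum_sub_sum_le (s := ν2) (t := B) (g := fun _ => (1 : ℝ)) (R := 1)
      (by simp) (by simp)
    rw [hB, sum_biUnion_double, ← hB] at h
    simp only [Finset.sum_const, nsmul_eq_mul, mul_one, one_add_one_eq_two] at h
    rw [mul_comm (ν.card : ℝ)] at h
    exact h.trans hcard
  have hT0 : 0 ≤ T := Finset.sum_nonneg fun i hi =>
    (hF0 _ (hI _ (Finset.mem_filter.1 hi).2)).le
  have hTR : T ≤ ν2.card * R := by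
    rw [← nsmul_eq_mul]
    exact Finset.sum_le_card_nsmul _ _ _ fun i hi => (le_abs_self _).trans (hgν2 i hi)
  have hηle : η ≤ (N : ℝ) ^ (-(β * ρ)) * ℓ ^ 3 := by
    rw [hη]
    refine mul_le_mul ?_ (le_self_pow₀ hlog three_ne_zero) hℓ0.le (Real.rpow_nonneg hN'.le _)
    refine Real.rpow_le_rpow_of_exponent_le (by linarith) (neg_le_neg ?_)
    exact mul_le_of_le_one_left (by linarith) hβ1.2
  have hdiff : |W / S - (ν.card : ℝ) / ν2.card * (T / S)| ≤
      K * η + (L + 1) * ((1 + 2 * K) * c₂ * X) :=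
    abs_div_sub_mul_div_le (r := (1 + 2 * K) * c₂ * X) (e := K * η) (c := (L : ℝ) + 1) hS
      (by positivity) (by positivity) (by positivity) (Nat.cast_nonneg _) hT0 hTR hTB hBW hcards
  refine hdiff.trans ?_
  have hc₃X : (L + 1) * ((1 + 2 * K) * c₂ * X) = c₃ * X := by
    rw [hc₃]
    ring
  rw [hc₃X]
  have hc₃0 : 0 ≤ c₃ := by positivity
  calc K * η + c₃ * X ≤ (K + c₃) * ((N : ℝ) ^ (-(β * ρ)) * ℓ ^ 3) + (K + c₃) * X := by
        gcongr <;> linarith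
    _ = _ := by rw [hX]; ring
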